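/- arXiv:2402.11918 — 2 statements merged into one kernel-verified Lean document; each statement's English description precedes it below -/
import Mathlib

section
/- Let X be a subset of H. Then there exists a matching μ_X in the induced subgraph G⟨V \ X⟩ such that μ_X ⊆ Ch_D(E \ B_X) and μ_X(d) ≠ ∅ for every doctor d ∈ D[E \ B_X]. -/
open Set

/-- `incid v e` : edge `e` is incident to vertex `v`. -/
def incid {V : Type*} (v : V) (e : V × V) : Prop := e.1 = v ∨ e.2 = v

/-- An instance of the super-stable matching problem with ties: a finite simple
bipartite graph whose vertices are partitioned into doctors `Dset` and
hospitals `Hset`, each edge `(d,h)` joining a doctor to a hospital, together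
with, for each vertex `v`, a transitive and total preference relation
`pref v` (possibly with ties) on the edges incident to `v`. -/
structure SMInstance (V : Type*) where
  Dset : Set V
  Hset : Set V
  E : Set (V × V)
  pref : V → (V × V) → (V × V) → Prop
  disj : Disjoint Dset Hset
  cover : Dset ∪ Hset = Set.univ
  edge_mem : ∀ e ∈ E, e.1 ∈ Dset ∧ e.2 ∈ Hset
  pref_total : ∀ v, ∀ e ∈ E, ∀ f ∈ E, incid v e → incid v f →
    pref v e f ∨ pref v f e
  pref_trans : ∀ v, ∀ e ∈ E, ∀ f ∈ E, ∀ g ∈ E,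
    incid v e → incid v f → incid v g →
    pref v e f → pref v f g → pref v e g

namespace SMInstance

variable {V : Type*} (I : SMInstance V)

/-- Strict preference `e ≻_v f`. -/
def sprefer (v : V) (e f : V × V) : Prop := I.pref v e f ∧ ¬ I.pref v f e

/-- `Ch_d(F)` for a doctor `d`. -/
def Chd (d : V) (F : Set (V × V)) : Set (V × V) :=
  {e ∈ F | incid d e ∧ ∀ f ∈ F, incid d f → I.pref d e f}

/-- `Ch_h(F)` for a hospital `h`. -/
def Chh (h : V) (F : Set (V × V)) : Set (V × V) :=
  {e ∈ F | incid h e ∧ ∀ f ∈ F, incid h f → f ≠ e → I.sprefer h e f}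

/-- `Ch_D(F) = ⋃_{d ∈ D} Ch_d(F)`. -/
def ChD (F : Set (V × V)) : Set (V × V) := ⋃ d ∈ I.Dset, I.Chd d F

/-- `Ch_H(F) = ⋃_{h ∈ H} Ch_h(F)`. -/
def ChH (F : Set (V × V)) : Set (V × V) := ⋃ h ∈ I.Hset, I.Chh h F

/-- `D[F]` : the set of doctors incident to some edge of `F`. -/
def docs (F : Set (V × V)) : Set V := {d ∈ I.Dset | ∃ e ∈ F, incid d e}

/-- The sequence `R_{X,t}` of the preprocessing algorithm:
`R_{X,0} = E(X)`, and `R_{X,t+1} = R_{X,t} ∪ (P_{X,t+1} \ Q_{X,t+1})` where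
`P_{X,t+1} = Ch_D(E \ R_{X,t})` and
`Q_{X,t+1} = Ch_H(P_{X,t+1} ∪ R_{X,t}) ∩ P_{X,t+1}`. -/
def R (X : Set V) : ℕ → Set (V × V)
  | 0 => {e ∈ I.E | e.2 ∈ X}
  | t + 1 =>
      R X t ∪
        (I.ChD (I.E \ R X t) \
          (I.ChH (I.ChD (I.E \ R X t) ∪ R X t) ∩ I.ChD (I.E \ R X t)))

/-- `k_X` : the least `t ≥ 1` with `R_{X,t} = R_{X,t-1}`. -/
noncomputable def kX (X : Set V) : ℕ :=
  sInf {t : ℕ | 1 ≤ t ∧ I.R X t = I.R X (t - 1)}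

/-- `B_X = R_{X,k_X}`. -/
noncomputable def B (X : Set V) : Set (V × V) := I.R X (I.kX X)

/-- A matching in the induced subgraph `G⟨V \ X⟩`. -/
def isMatching (X : Set V) (μ : Set (V × V)) : Prop :=
  μ ⊆ I.E ∧ (∀ e ∈ μ, e.1 ∉ X ∧ e.2 ∉ X) ∧
    ∀ v, ∀ e ∈ μ, ∀ f ∈ μ, incid v e → incid v f → e = f

/-- `e = (d,h)` blocks the matching `μ` of `G⟨V \ X⟩`:
`e ∈ E⟨V \ X⟩ \ μ`, `e ≿_d μ(d)` and `e ≿_h μ(h)`. -/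
def blocks (X : Set V) (μ : Set (V × V)) (e : V × V) : Prop :=
  e ∈ I.E ∧ e.1 ∉ X ∧ e.2 ∉ X ∧ e ∉ μ ∧
    (∀ f ∈ μ, incid e.1 f → I.pref e.1 e f) ∧
    (∀ f ∈ μ, incid e.2 f → I.pref e.2 e f)

/-- `μ` is a super-stable matching in `G⟨V \ X⟩`. -/
def superStable (X : Set V) (μ : Set (V × V)) : Prop :=
  I.isMatching X μ ∧ ∀ e, ¬ I.blocks X μ e

/-- `X` is feasible: `G⟨V \ X⟩` admits a super-stable matching. -/
def feasible (X : Set V) : Prop := ∃ μ, I.superStable X μ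

/-- `h` is a critical hospital with respect to `(B_X, μ_X)`:
`μ_X(h) = ∅` and at least one of `B_X(h) ≠ ∅` and
`Ch_D(E \ B_X) ∩ E(h) ≠ ∅` holds. -/
def critical (X : Set V) (μ : Set (V × V)) (h : V) : Prop :=
  h ∈ I.Hset ∧ (∀ e ∈ μ, ¬ incid h e) ∧
    ((∃ e ∈ I.B X, incid h e) ∨ ∃ e ∈ I.ChD (I.E \ I.B X), incid h e)

end SMInstance

namespace SMInstance

variable {V : Type*} (I : SMInstance V)

theorem exists_pref_greatest (v : V) {S : Set (V × V)} (hfin : S.Finite) (hne : S.Nonempty)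
    (hS : ∀ e ∈ S, e ∈ I.E ∧ incid v e) : ∃ e ∈ S, ∀ f ∈ S, I.pref v e f := by
  induction S, hfin using Set.Finite.induction_on with
  | empty => exact absurd hne Set.not_nonempty_empty
  | @insert a s _ _ ih =>
    have ha := hS a (Set.mem_insert a s)
    have hs : ∀ e ∈ s, e ∈ I.E ∧ incid v e := fun e he => hS e (Set.mem_insert_of_mem a he)
    have haa : I.pref v a a := or_self_iff.mp (I.pref_total v a ha.1 a ha.1 ha.2 ha.2)
    rcases s.eq_empty_or_nonempty with rfl | hsne
    · refine ⟨a, Set.mem_insert a _, ?_⟩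
      rintro f (rfl | hf)
      · exact haa
      · exact absurd hf (Set.notMem_empty f)
    · obtain ⟨b, hb, hbest⟩ := ih hsne hs
      rcases I.pref_total v a ha.1 b (hs b hb).1 ha.2 (hs b hb).2 with hab | hba
      · refine ⟨a, Set.mem_insert a s, ?_⟩
        rintro f (rfl | hf)
        · exact haa
        · exact I.pref_trans v a ha.1 b (hs b hb).1 f (hs f hf).1 ha.2 (hs b hb).2 (hs f hf).2
            hab (hbest f hf)
      · refine ⟨b, Set.mem_insert_of_mem a hb, ?_⟩
        rintro f (rfl | hf)
        · exact hba
        · exact hbest f hf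

theorem R_mono (X : Set V) : Monotone (I.R X) :=
  monotone_nat_of_le_succ fun _ => Set.subset_union_left

theorem R_kX [Finite V] (X : Set V) : 1 ≤ I.kX X ∧ I.R X (I.kX X) = I.R X (I.kX X - 1) := by
  obtain ⟨n, hn⟩ := WellFoundedGT.monotone_chain_condition ⟨I.R X, I.R_mono X⟩
  exact Nat.sInf_mem (s := {t : ℕ | 1 ≤ t ∧ I.R X t = I.R X (t - 1)})
    ⟨n + 1, Nat.le_add_left 1 n, (hn (n + 1) n.le_succ).symm⟩

theorem ChD_diff_B_subset_ChH [Finite V] (X : Set V) :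
    I.ChD (I.E \ I.B X) ⊆ I.ChH (I.ChD (I.E \ I.B X) ∪ I.B X) := by
  intro e he
  obtain ⟨hk, hR⟩ := I.R_kX X
  obtain ⟨n, hn⟩ := Nat.exists_eq_add_of_le' hk
  have hB : I.B X = I.R X n := by rw [B, hR, hn, Nat.add_sub_cancel]
  have hsucc : I.R X (n + 1) = I.R X n := by rw [← hn, ← hB, B]
  obtain ⟨d, -, hd⟩ := Set.mem_iUnion₂.mp he
  have heB : e ∉ I.R X (n + 1) := by
    rw [hsucc, ← hB]
    exact hd.1.2
  rw [hB] at he ⊢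
  by_contra hne
  exact heB (Or.inr ⟨he, fun h => hne h.1⟩)

theorem fst_eq_of_incid {d : V} {e : V × V} (hd : d ∈ I.Dset) (he : e ∈ I.E)
    (h : incid d e) : e.1 = d :=
  h.resolve_right fun h2 => Set.disjoint_left.mp I.disj hd (h2 ▸ (I.edge_mem e he).2)

theorem snd_eq_of_incid {h : V} {e : V × V} (hh : h ∈ I.Hset) (he : e ∈ I.E)
    (hi : incid h e) : e.2 = h :=
  hi.resolve_left fun h1 => Set.disjoint_left.mp I.disj (h1 ▸ (I.edge_mem e he).1) hh

theorem eq_of_mem_ChH {F : Set (V × V)} {e f : V × V} (heE : e ∈ I.E) (he : e ∈ I.ChH F)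
    (hfE : f ∈ I.E) (hf : f ∈ I.ChH F) (hef : e.2 = f.2) : e = f := by
  obtain ⟨h, hh, heF, heh, hebest⟩ := Set.mem_iUnion₂.mp he
  obtain ⟨h', hh', hfF, hfh, hfbest⟩ := Set.mem_iUnion₂.mp hf
  obtain rfl : h = h' :=
    ((I.snd_eq_of_incid hh heE heh).symm.trans hef).trans (I.snd_eq_of_incid hh' hfE hfh)
  by_contra hne
  exact (hebest f hfF hfh (Ne.symm hne)).2 (hfbest e heF heh hne).1

theorem ChD_subset (F : Set (V × V)) : I.ChD F ⊆ F := by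
  intro e he
  obtain ⟨d, -, hd⟩ := Set.mem_iUnion₂.mp he
  exact hd.1

theorem exists_mem_ChD [Finite V] {F : Set (V × V)} (hF : F ⊆ I.E) {d : V}
    (hd : d ∈ I.docs F) : ∃ e ∈ I.ChD F, incid d e := by
  obtain ⟨hdD, e, he, hde⟩ := hd
  obtain ⟨g, hg, hbest⟩ := I.exists_pref_greatest d (S := {f ∈ F | incid d f})
    (Set.toFinite _) ⟨e, he, hde⟩ fun f hf => ⟨hF hf.1, hf.2⟩
  exact ⟨g, Set.mem_iUnion₂.mpr ⟨d, hdD, hg.1, hg.2, fun f hf hdf => hbest f ⟨hf, hdf⟩⟩, hg.2⟩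

end SMInstance

/-- Let `X ⊆ H`. Then there exists a matching `μ_X` in `G⟨V \ X⟩` such that
`μ_X ⊆ Ch_D(E \ B_X)` and `μ_X(d) ≠ ∅` for every doctor `d ∈ D[E \ B_X]`. -/
theorem statement3 {V : Type*} [Fintype V] (I : SMInstance V)
    (X : Set V) (hX : X ⊆ I.Hset) :
    ∃ μ : Set (V × V), I.isMatching X μ ∧ μ ⊆ I.ChD (I.E \ I.B X) ∧
      ∀ d ∈ I.docs (I.E \ I.B X), ∃ e ∈ μ, incid d e := by
  have hchoice : ∀ d : V, ∃ e, d ∈ I.docs (I.E \ I.B X) →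
      e ∈ I.ChD (I.E \ I.B X) ∧ incid d e := fun d => by
    by_cases hd : d ∈ I.docs (I.E \ I.B X)
    · obtain ⟨e, he⟩ := I.exists_mem_ChD Set.sdiff_subset hd
      exact ⟨e, fun _ => he⟩
    · exact ⟨(d, d), fun h => absurd h hd⟩
  choose c hc using hchoice
  have hsub : c '' I.docs (I.E \ I.B X) ⊆ I.ChD (I.E \ I.B X) := by
    rintro _ ⟨d, hd, rfl⟩
    exact (hc d hd).1
  have hdiff : c '' I.docs (I.E \ I.B X) ⊆ I.E \ I.B X := hsub.trans (I.ChD_subset _)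
  have hE : c '' I.docs (I.E \ I.B X) ⊆ I.E := hdiff.trans Set.sdiff_subset
  refine ⟨c '' I.docs (I.E \ I.B X), ⟨hE, fun e he => ⟨fun h1 => ?_, fun h2 => ?_⟩, ?_⟩, hsub,
    fun d hd => ⟨c d, Set.mem_image_of_mem c hd, (hc d hd).2⟩⟩
  · exact Set.disjoint_left.mp I.disj (I.edge_mem e (hE he)).1 (hX h1)
  · exact (hdiff he).2 (I.R_mono X (Nat.zero_le (I.kX X)) ⟨hE he, h2⟩)
  · intro v e he f hf hve hvf
    have hv : v ∈ I.Dset ∪ I.Hset := I.cover ▸ Set.mem_univ v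
    rcases hv with hvD | hvH
    · have key : ∀ g ∈ c '' I.docs (I.E \ I.B X), incid v g → g = c v := by
        intro g hg hvg
        have hgE := hE hg
        obtain ⟨d, hd, rfl⟩ := hg
        rw [← I.fst_eq_of_incid hvD hgE hvg, I.fst_eq_of_incid hd.1 hgE (hc d hd).2]
      rw [key e he hve, key f hf hvf]
    · exact I.eq_of_mem_ChH (hE he) (I.ChD_diff_B_subset_ChH X (hsub he)) (hE hf)
        (I.ChD_diff_B_subset_ChH X (hsub hf))
        ((I.snd_eq_of_incid hvH (hE he) hve).trans (I.snd_eq_of_incid hvH (hE hf) hvf).symm)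
end

section
/- Let q be a non-negative integer. Then there exists an element X ∈ F_H with |X| ≤ q if and only if |S_∅| ≤ q. -/
open Set

namespace SMInstance

variable {V : Type*} (I : SMInstance V)

lemma incid_doctor_iff {d : V} {e : V × V} (hd : d ∈ I.Dset) (he : e ∈ I.E) :
    incid d e ↔ e.1 = d := by
  refine ⟨fun h => h.elim id fun h2 => ?_, Or.inl⟩
  exact (Set.disjoint_left.1 I.disj hd (h2 ▸ (I.edge_mem e he).2)).elim

lemma incid_hospital_iff {h : V} {e : V × V} (hh : h ∈ I.Hset) (he : e ∈ I.E) :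
    incid h e ↔ e.2 = h := by
  refine ⟨fun h' => h'.elim (fun h1 => ?_) id, Or.inr⟩
  exact (Set.disjoint_right.1 I.disj hh (h1 ▸ (I.edge_mem e he).1)).elim

lemma mem_ChD_iff {F : Set (V × V)} (hF : F ⊆ I.E) {e : V × V} :
    e ∈ I.ChD F ↔ e ∈ F ∧ ∀ f ∈ F, f.1 = e.1 → I.pref e.1 e f := by
  simp only [ChD, Chd, mem_iUnion, mem_ofPred_eq, exists_prop]
  constructor
  · rintro ⟨d, hd, he, hde, hmax⟩
    have h1 := (I.incid_doctor_iff hd (hF he)).1 hde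
    subst h1
    exact ⟨he, fun f hf hfe => hmax f hf (Or.inl hfe)⟩
  · rintro ⟨he, hmax⟩
    have hd := (I.edge_mem e (hF he)).1
    exact ⟨e.1, hd, he, Or.inl rfl,
      fun f hf hfe => hmax f hf ((I.incid_doctor_iff hd (hF hf)).1 hfe)⟩

lemma mem_ChH_iff {F : Set (V × V)} (hF : F ⊆ I.E) {e : V × V} :
    e ∈ I.ChH F ↔ e ∈ F ∧ ∀ f ∈ F, f.2 = e.2 → f ≠ e → I.sprefer e.2 e f := by
  simp only [ChH, Chh, mem_iUnion, mem_ofPred_eq, exists_prop]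
  constructor
  · rintro ⟨h, hh, he, hhe, hmax⟩
    have h2 := (I.incid_hospital_iff hh (hF he)).1 hhe
    subst h2
    exact ⟨he, fun f hf hfe => hmax f hf (Or.inr hfe)⟩
  · rintro ⟨he, hmax⟩
    have hh := (I.edge_mem e (hF he)).2
    exact ⟨e.2, hh, he, Or.inr rfl,
      fun f hf hfe => hmax f hf ((I.incid_hospital_iff hh (hF hf)).1 hfe)⟩

lemma ChD_diff_subset (F : Set (V × V)) : I.ChD (I.E \ F) ⊆ I.E \ F :=
  fun _ he => ((I.mem_ChD_iff sdiff_subset).1 he).1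

lemma R_subset (X : Set V) (t : ℕ) : I.R X t ⊆ I.E := by
  induction t with
  | zero => exact fun e he => he.1
  | succ t ih => exact union_subset ih fun e he => (I.ChD_diff_subset _ he.1).1

lemma R_succ_B [Finite V] (X : Set V) : I.R X (I.kX X + 1) = I.B X := by
  have hne : {t : ℕ | 1 ≤ t ∧ I.R X t = I.R X (t - 1)}.Nonempty := by
    obtain ⟨n, hn⟩ := WellFoundedGT.monotone_chain_condition
      (⟨I.R X, monotone_nat_of_le_succ fun _ => subset_union_left⟩ : ℕ →o Set (V × V))
    exact ⟨n + 1, Nat.le_add_left 1 n, (hn (n + 1) n.le_succ).symm⟩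
  obtain ⟨hk, hR⟩ : 1 ≤ I.kX X ∧ I.R X (I.kX X) = I.R X (I.kX X - 1) := Nat.sInf_mem hne
  unfold B
  obtain ⟨k, hk'⟩ := Nat.exists_eq_add_of_le' hk
  rw [hk'] at hR ⊢
  rw [Nat.add_sub_cancel] at hR
  conv_lhs => rw [R, hR]
  rfl

/-- Every edge proposed after the preprocessing has terminated is strictly preferred by its
hospital to every other proposed or rejected edge. -/
lemma sprefer_of_mem_ChD_B [Finite V] (X : Set V) {e f : V × V}
    (he : e ∈ I.ChD (I.E \ I.B X)) (hf : f ∈ I.ChD (I.E \ I.B X) ∪ I.B X)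
    (h2 : f.2 = e.2) (hne : f ≠ e) : I.sprefer e.2 e f := by
  have hsub : I.ChD (I.E \ I.B X) ∪ I.B X ⊆ I.E :=
    union_subset ((I.ChD_diff_subset _).trans sdiff_subset) (I.R_subset X _)
  have hH : e ∈ I.ChH (I.ChD (I.E \ I.B X) ∪ I.B X) := by
    by_contra hc
    have : e ∈ I.R X (I.kX X + 1) := Or.inr ⟨he, fun h => hc h.1⟩
    rw [R_succ_B] at this
    exact (I.ChD_diff_subset _ he).2 this
  exact ((I.mem_ChH_iff hsub).1 hH).2 f hf h2 hne

/-- Deleting the critical hospitals makes the given matching super-stable. -/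
lemma superStable_critical [Finite V] {μ : Set (V × V)} (hμ : I.isMatching ∅ μ)
    (hμCh : μ ⊆ I.ChD (I.E \ I.B ∅))
    (hμcov : ∀ d ∈ I.docs (I.E \ I.B ∅), ∃ e ∈ μ, incid d e) :
    I.superStable {h | I.critical ∅ μ h} μ := by
  refine ⟨⟨hμ.1, fun e he => ⟨fun h => h.2.1 e he (Or.inl rfl),
    fun h => h.2.1 e he (Or.inr rfl)⟩, hμ.2.2⟩, ?_⟩
  rintro e ⟨heE, -, he2, heμ, hbd, hbh⟩
  have hmem : e ∈ I.ChD (I.E \ I.B ∅) ∪ I.B ∅ := by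
    by_cases heB : e ∈ I.B ∅
    · exact Or.inr heB
    left
    have hd := (I.edge_mem e heE).1
    obtain ⟨g, hg, hdg⟩ := hμcov e.1 ⟨hd, e, ⟨heE, heB⟩, Or.inl rfl⟩
    have hge := (I.incid_doctor_iff hd (hμ.1 hg)).1 hdg
    have hgmax := ((I.mem_ChD_iff sdiff_subset).1 (hμCh hg)).2
    rw [hge] at hgmax
    refine (I.mem_ChD_iff sdiff_subset).2 ⟨⟨heE, heB⟩, fun f hf hfe => ?_⟩
    exact I.pref_trans e.1 e heE g (hμ.1 hg) f hf.1 (Or.inl rfl) hdg (Or.inl hfe)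
      (hbd g hg hdg) (hgmax f hf hfe)
  have hh := (I.edge_mem e heE).2
  obtain ⟨f, hf, hef⟩ : ∃ f ∈ μ, incid e.2 f := by
    by_contra! hc
    exact he2 ⟨hh, hc, hmem.symm.imp (fun h => ⟨e, h, Or.inr rfl⟩)
      fun h => ⟨e, h, Or.inr rfl⟩⟩
  have hfe := (I.incid_hospital_iff hh (hμ.1 hf)).1 hef
  have hs := I.sprefer_of_mem_ChD_B ∅ (hμCh hf) hmem hfe.symm fun h => heμ (h ▸ hf)
  rw [hfe] at hs
  exact hs.2 (hbh f hf hef)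

variable {I} in
/-- An edge that its doctor weakly prefers to the matching `σ` and that avoids `X` is not weakly
preferred by its hospital to `σ`, unless it belongs to `σ`. -/
lemma superStable.mem_of_pref {X : Set V} {σ : Set (V × V)} (hσ : I.superStable X σ)
    (hX : X ⊆ I.Hset) {e : V × V} (heE : e ∈ I.E) (he2 : e.2 ∉ X)
    (hd : ∀ f ∈ σ, f.1 = e.1 → I.pref e.1 e f)
    (hh : ∀ f ∈ σ, f.2 = e.2 → I.pref e.2 e f) : e ∈ σ := by
  by_contra hc
  have hmem := I.edge_mem e heE
  exact hσ.2 e ⟨heE, fun h => Set.disjoint_left.1 I.disj hmem.1 (hX h), he2, hc,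
    fun f hf hi => hd f hf ((I.incid_doctor_iff hmem.1 (hσ.1.1 hf)).1 hi),
    fun f hf hi => hh f hf ((I.incid_hospital_iff hmem.2 (hσ.1.1 hf)).1 hi)⟩

lemma pref_of_mem_ChD {F σ : Set (V × V)} (hσE : σ ⊆ I.E) (hσF : Disjoint σ F)
    {e : V × V} (he : e ∈ I.ChD (I.E \ F)) : ∀ f ∈ σ, f.1 = e.1 → I.pref e.1 e f :=
  fun f hf => ((I.mem_ChD_iff sdiff_subset).1 he).2 f ⟨hσE hf, Set.disjoint_left.1 hσF hf⟩

variable {I} in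
/-- The preprocessing never rejects an edge of a super-stable matching obtained by deleting
hospitals, and rejected edges are weakly preferred by their doctors to that matching. -/
lemma superStable.disjoint_R {X : Set V} {σ : Set (V × V)} (hσ : I.superStable X σ)
    (hX : X ⊆ I.Hset) (t : ℕ) :
    Disjoint σ (I.R ∅ t) ∧ ∀ e ∈ I.R ∅ t, ∀ f ∈ σ, f.1 = e.1 → I.pref e.1 e f := by
  induction t with
  | zero => exact ⟨Set.disjoint_left.2 fun e _ he => he.2, fun e he => he.2.elim⟩
  | succ t ih =>
    obtain ⟨hdisj, hpref⟩ := ih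
    have hP : ∀ e ∈ I.ChD (I.E \ I.R ∅ t) ∪ I.R ∅ t,
        ∀ f ∈ σ, f.1 = e.1 → I.pref e.1 e f := fun e he =>
      he.elim (fun h => I.pref_of_mem_ChD hσ.1.1 hdisj h) (hpref e)
    have hsub : I.ChD (I.E \ I.R ∅ t) ∪ I.R ∅ t ⊆ I.E :=
      union_subset ((I.ChD_diff_subset _).trans sdiff_subset) (I.R_subset ∅ _)
    refine ⟨Set.disjoint_left.2 fun e heσ he => ?_,
      fun e he => hP e (he.elim Or.inr fun h => Or.inl h.1)⟩
    rcases he with he | ⟨heP, heQ⟩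
    · exact Set.disjoint_left.1 hdisj heσ he
    refine heQ ⟨(I.mem_ChH_iff hsub).2 ⟨Or.inl heP, fun f hf hfe hne => ?_⟩, heP⟩
    have heE := hσ.1.1 heσ
    have hunique : ∀ g ∈ σ, g.2 = e.2 → g = e := fun g hg hge =>
      hσ.1.2.2 e.2 g hg e heσ (Or.inr hge) (Or.inr rfl)
    have hnot : ¬ I.pref e.2 f e := fun hfe' => hne <| hunique f
      (hσ.mem_of_pref hX (hsub hf) (hfe ▸ (hσ.1.2.1 e heσ).2) (hP f hf)
        fun g hg hgf => by rw [hunique g hg (hgf.trans hfe), hfe]; exact hfe') hfe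
    exact ⟨(I.pref_total e.2 e heE f (hsub hf) (Or.inr rfl) (Or.inr hfe)).resolve_right hnot,
      hnot⟩

lemma ncard_critical_le [Finite V] {μ : Set (V × V)} (hμ : I.isMatching ∅ μ)
    (hμCh : μ ⊆ I.ChD (I.E \ I.B ∅))
    (hμcov : ∀ d ∈ I.docs (I.E \ I.B ∅), ∃ e ∈ μ, incid d e)
    {X : Set V} (hX : X ⊆ I.Hset) (hfeas : I.feasible X) :
    {h | I.critical ∅ μ h}.ncard ≤ X.ncard := by
  obtain ⟨σ, hσ⟩ := hfeas
  obtain ⟨hdisj, hpref⟩ : Disjoint σ (I.B ∅) ∧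
    ∀ e ∈ I.B ∅, ∀ f ∈ σ, f.1 = e.1 → I.pref e.1 e f := hσ.disjoint_R hX _
  have htouch : ∀ e ∈ I.ChD (I.E \ I.B ∅) ∪ I.B ∅, e.2 ∈ X ∪ Prod.snd '' σ := by
    intro e he
    by_contra hc
    rw [mem_union, not_or] at hc
    have heE : e ∈ I.E := he.elim (fun h => (I.ChD_diff_subset _ h).1) fun h => I.R_subset ∅ _ h
    exact hc.2 ⟨e, hσ.mem_of_pref hX heE hc.1
      (he.elim (fun h => I.pref_of_mem_ChD hσ.1.1 hdisj h) (hpref e))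
      fun f hf hfe => (hc.2 ⟨f, hf, hfe⟩).elim, rfl⟩
  have hsub : {h | I.critical ∅ μ h} ∪ Prod.snd '' μ ⊆ X ∪ Prod.snd '' σ := by
    rintro h (⟨hh, -, ⟨e, he, hhe⟩ | ⟨e, he, hhe⟩⟩ | ⟨e, he, rfl⟩)
    · rw [← (I.incid_hospital_iff hh (I.R_subset ∅ _ he)).1 hhe]
      exact htouch e (Or.inr he)
    · rw [← (I.incid_hospital_iff hh (I.ChD_diff_subset _ he).1).1 hhe]
      exact htouch e (Or.inl he)
    · exact htouch e (Or.inl (hμCh he))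
  have hcrit : Disjoint {h | I.critical ∅ μ h} (Prod.snd '' μ) := by
    rw [Set.disjoint_left]
    rintro _ hc ⟨e, he, rfl⟩
    exact hc.2.1 e he (Or.inr rfl)
  have hfst : Prod.fst '' σ ⊆ Prod.fst '' μ := by
    rintro _ ⟨e, he, rfl⟩
    have hd := (I.edge_mem e (hσ.1.1 he)).1
    obtain ⟨g, hg, hdg⟩ := hμcov e.1
      ⟨hd, e, ⟨hσ.1.1 he, Set.disjoint_left.1 hdisj he⟩, Or.inl rfl⟩
    exact ⟨g, hg, (I.incid_doctor_iff hd (hμ.1 hg)).1 hdg⟩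
  have hσinj : InjOn Prod.fst σ := fun e he f hf hef =>
    hσ.1.2.2 f.1 e he f hf (Or.inl hef) (Or.inl rfl)
  have hμinj : InjOn Prod.snd μ := fun e he f hf hef =>
    hμ.2.2 f.2 e he f hf (Or.inr hef) (Or.inr rfl)
  have h1 := ncard_le_ncard hsub
  rw [ncard_union_eq hcrit, hμinj.ncard_image] at h1
  have h2 := ncard_union_le X (Prod.snd '' σ)
  have h3 : (Prod.snd '' σ).ncard ≤ σ.ncard := ncard_image_le
  have h4 := ncard_le_ncard hfst
  rw [hσinj.ncard_image] at h4
  have h5 : (Prod.fst '' μ).ncard ≤ μ.ncard := ncard_image_le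
  omega

end SMInstance

/-- Let `q` be a non-negative integer. Then there exists `X ∈ F_H` with
`|X| ≤ q` if and only if `|S_∅| ≤ q`. -/
theorem statement11 {V : Type*} [Fintype V] (I : SMInstance V)
    (μ0 : Set (V × V)) (hμ0 : I.isMatching (∅ : Set V) μ0)
    (hμ0Ch : μ0 ⊆ I.ChD (I.E \ I.B (∅ : Set V)))
    (hμ0cov : ∀ d ∈ I.docs (I.E \ I.B (∅ : Set V)), ∃ e ∈ μ0, incid d e)
    (q : ℕ) :
    (∃ X : Set V, X ⊆ I.Hset ∧ I.feasible X ∧ X.ncard ≤ q) ↔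
      {h | I.critical (∅ : Set V) μ0 h}.ncard ≤ q := by
  refine ⟨fun ⟨X, hX, hfeas, hq⟩ =>
    (I.ncard_critical_le hμ0 hμ0Ch hμ0cov hX hfeas).trans hq, fun hq => ?_⟩
  exact ⟨_, fun h hh => hh.1, ⟨μ0, I.superStable_critical hμ0 hμ0Ch hμ0cov⟩, hq⟩
end
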